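/- For every complex number d with Re(d) > 0, there holds ₃F₂(5/2, −3/2, d+1; 9/2, d; 1) = (105π/1024)(1 − 3/(2d)). -/

import Mathlib

open scoped Nat

/-- Pochhammer symbol `(x)_k = x (x+1) ⋯ (x+k-1)` for a complex number `x`. -/
noncomputable def poch (x : ℂ) (k : ℕ) : ℂ := (ascPochhammer ℂ k).eval x

/-- The generalized hypergeometric series
`ₚF_q(a₁,…,aₚ; b₁,…,b_q; z) = ∑ₖ ((a₁)ₖ ⋯ (aₚ)ₖ)/((b₁)ₖ ⋯ (b_q)ₖ) · zᵏ/k!`. -/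
noncomputable def hyp (a b : List ℂ) (z : ℂ) : ℂ :=
  ∑' k : ℕ, ((a.map (poch · k)).prod / (b.map (poch · k)).prod) * z ^ k / (k ! : ℂ)

open Complex Filter Topology

theorem poch_succ (x : ℂ) (k : ℕ) : poch x (k + 1) = poch x k * (x + k) :=
  ascPochhammer_succ_eval k x

theorem poch_succ_left (x : ℂ) (k : ℕ) : poch x (k + 1) = x * poch (x + 1) k := by
  simp [poch, ascPochhammer_succ_left]

theorem poch_ne_zero {x : ℂ} (hx : 0 < x.re) (k : ℕ) : poch x k ≠ 0 := by
  rw [poch, Ne, ascPochhammer_eval_eq_zero_iff]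
  rintro ⟨j, -, h⟩
  have := congrArg re h
  simp at this
  linarith [Nat.cast_nonneg (α := ℝ) j]

theorem poch_add_one_div {x : ℂ} (hx : 0 < x.re) (k : ℕ) :
    poch (x + 1) k / poch x k = 1 + k / x := by
  have hx0 : x ≠ 0 := by rintro rfl; simp at hx
  have h : x * poch (x + 1) k = poch x k * (x + k) := by rw [← poch_succ_left, poch_succ]
  rw [div_eq_iff (poch_ne_zero hx k)]
  field_simp
  linear_combination h

theorem poch_five_halves_div (k : ℕ) :
    poch (5 / 2) k / poch (9 / 2) k = 35 / ((2 * k + 5) * (2 * k + 7)) := by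
  have h₁ := poch_add_one_div (x := 5 / 2) (by norm_num) k
  have h₂ := poch_add_one_div (x := 7 / 2) (by norm_num) k
  norm_num at h₁ h₂
  have e : poch (5 / 2) k / poch (9 / 2) k
      = (poch (7 / 2) k / poch (5 / 2) k)⁻¹ * (poch (9 / 2) k / poch (7 / 2) k)⁻¹ := by
    have := poch_ne_zero (x := 7 / 2) (by norm_num) k
    field_simp
  have h5 : (2 * k + 5 : ℂ) ≠ 0 := by exact_mod_cast (by omega : 2 * k + 5 ≠ 0)
  have h7 : (2 * k + 7 : ℂ) ≠ 0 := by exact_mod_cast (by omega : 2 * k + 7 ≠ 0)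
  have e₁ : (1 + k / (5 / 2) : ℂ) = (2 * k + 5) / 5 := by ring
  have e₂ : (1 + k / (7 / 2) : ℂ) = (2 * k + 7) / 7 := by ring
  rw [e, h₁, h₂, e₁, e₂]
  field_simp
  norm_num

/-- The coefficients of the power series of `(1 - x) ^ (3 / 2)`. -/
noncomputable def binomCoeff (k : ℕ) : ℂ := poch (-3 / 2) k / (k ! : ℂ)

theorem binomCoeff_succ (k : ℕ) :
    binomCoeff (k + 1) = binomCoeff k * ((k - 3 / 2) / (k + 1)) := by
  have h : (k + 1 : ℂ) ≠ 0 := by exact_mod_cast k.succ_ne_zero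
  have h' : (k ! : ℂ) ≠ 0 := by exact_mod_cast k.factorial_ne_zero
  rw [binomCoeff, binomCoeff, poch_succ, Nat.factorial_succ]
  push_cast
  field_simp
  ring

theorem norm_binomCoeff_succ (k : ℕ) :
    ‖binomCoeff (k + 1)‖ = ‖binomCoeff k‖ * (|(k : ℝ) - 3 / 2| / (k + 1)) := by
  have h : ((k : ℂ) - 3 / 2) / (k + 1) = (((k : ℝ) - 3 / 2) / (k + 1) : ℝ) := by push_cast; rfl
  rw [binomCoeff_succ, norm_mul, h, norm_real, Real.norm_eq_abs, abs_div,
    abs_of_pos (by positivity : (0 : ℝ) < k + 1)]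

theorem norm_binomCoeff_mul_le (k : ℕ) : ‖binomCoeff k‖ * (k + 1) ^ 2 ≤ 6 := by
  have h0 : ‖binomCoeff 0‖ = 1 := by simp [binomCoeff, poch]
  have h1 : ‖binomCoeff 1‖ = 3 / 2 := by
    rw [norm_binomCoeff_succ, h0]; norm_num [abs_of_nonneg]
  have h2 : ‖binomCoeff 2‖ = 3 / 8 := by
    rw [norm_binomCoeff_succ, h1]; norm_num [abs_of_nonneg]
  rcases lt_or_ge k 2 with hk | hk
  · interval_cases k
    · rw [h0]; norm_num
    · rw [h1]; norm_num
  induction k, hk using Nat.le_induction with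
  | base => rw [h2]; norm_num
  | succ k hk ih =>
    refine le_trans ?_ ih
    have hk' : (2 : ℝ) ≤ k := by exact_mod_cast hk
    rw [norm_binomCoeff_succ, abs_of_nonneg (by linarith), mul_assoc]
    gcongr
    rw [div_mul_eq_mul_div, div_le_iff₀ (by positivity)]
    push_cast
    nlinarith [sq_nonneg (k : ℝ)]

theorem summable_norm_binomCoeff : Summable fun k ↦ ‖binomCoeff k‖ := by
  have h : Summable fun k : ℕ ↦ 6 * (1 / ((k + 1 : ℕ) : ℝ) ^ 2) :=
    ((summable_nat_add_iff 1).2 (Real.summable_one_div_nat_pow.2 one_lt_two)).mul_left 6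
  refine h.of_nonneg_of_le (fun _ ↦ norm_nonneg _) fun k ↦ ?_
  rw [mul_one_div, le_div_iff₀ (by positivity)]
  exact_mod_cast norm_binomCoeff_mul_le k

theorem hasSum_binomCoeff {x : ℝ} (hx0 : 0 < x) (hx1 : x < 1) :
    HasSum (fun k ↦ binomCoeff k * (x : ℂ) ^ k) ((1 - x : ℂ) ^ (3 / 2 : ℂ)) := by
  have h := (one_div_one_sub_cpow_hasFPowerSeriesOnBall_zero (-3 / 2)).hasSum (y := (x : ℂ))
    (by simpa [← ofReal_norm, abs_of_pos hx0] using hx1)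
  have e : (1 / (1 - (0 + x : ℂ)) ^ (-3 / 2 : ℂ)) = (1 - x : ℂ) ^ (3 / 2 : ℂ) := by
    rw [zero_add, show (-3 / 2 : ℂ) = -(3 / 2) by ring, cpow_neg, one_div, inv_inv]
  rw [e] at h
  convert! h using 2 with k
  rw [FormalMultilinearSeries.ofScalars_apply_eq, smul_eq_mul, binomCoeff, poch,
    Ring.choose, ← Polynomial.ascPochhammer_smeval_eq_eval,
    show (-3 / 2 + k - 1 - k + 1 : ℂ) = -3 / 2 by ring,
    Polynomial.ascPochhammer_smeval_cast, ← Ring.factorial_nsmul_multichoose_eq_ascPochhammer]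
  have h' : (k ! : ℂ) ≠ 0 := by exact_mod_cast k.factorial_ne_zero
  rw [nsmul_eq_mul, mul_div_cancel_left₀ _ h']

theorem betaIntegral_add_two (k : ℕ) :
    betaIntegral (k + 5 / 2) 2 = 4 / ((2 * k + 5) * (2 * k + 7)) := by
  have hre : 0 < (k + 5 / 2 : ℂ).re := by
    simp; positivity
  have h := Gamma_mul_Gamma_eq_betaIntegral hre (t := 2) (by norm_num)
  have h5 : (2 * k + 5 : ℂ) ≠ 0 := by exact_mod_cast (by omega : 2 * k + 5 ≠ 0)
  have h7 : (2 * k + 7 : ℂ) ≠ 0 := by exact_mod_cast (by omega : 2 * k + 7 ≠ 0)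
  have h5' : (k + 5 / 2 : ℂ) ≠ 0 := fun h ↦ h5 (by linear_combination 2 * h)
  have h7' : (k + 5 / 2 + 1 : ℂ) ≠ 0 := fun h ↦ h7 (by linear_combination 2 * h)
  have hG := Gamma_ne_zero_of_re_pos hre
  have h2 : Gamma 2 = 1 := by simp
  rw [h2, show (k + 5 / 2 + 2 : ℂ) = k + 5 / 2 + 1 + 1 by ring, Gamma_add_one _ h7',
    Gamma_add_one _ h5'] at h
  rw [eq_div_iff (mul_ne_zero h5 h7)]
  refine mul_left_cancel₀ hG ?_
  linear_combination -4 * h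

theorem betaIntegral_five_halves_seven_halves :
    betaIntegral (5 / 2) (7 / 2) = 3 * Real.pi / 256 := by
  have h := Gamma_mul_Gamma_eq_betaIntegral (s := 5 / 2) (t := 7 / 2) (by norm_num) (by norm_num)
  have h3 : Gamma (3 / 2) = 1 / 2 * Gamma (1 / 2) := by
    rw [← Gamma_add_one _ (by norm_num)]; norm_num
  have h5 : Gamma (5 / 2) = 3 / 2 * Gamma (3 / 2) := by
    rw [← Gamma_add_one _ (by norm_num)]; norm_num
  have h7 : Gamma (7 / 2) = 5 / 2 * Gamma (5 / 2) := by
    rw [← Gamma_add_one _ (by norm_num)]; norm_num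
  have h6 : Gamma (5 / 2 + 7 / 2) = 120 := by
    rw [show (5 / 2 + 7 / 2 : ℂ) = (5 : ℕ) + 1 by norm_num, Gamma_nat_eq_factorial]
    norm_num [Nat.factorial]
  have hpi : Gamma (1 / 2) * Gamma (1 / 2) = Real.pi := by
    rw [Gamma_one_half_eq, ← cpow_add _ _ (by exact_mod_cast Real.pi_ne_zero)]
    norm_num
  rw [h6, h7, h5, h3] at h
  linear_combination (-1 / 120 : ℂ) * h + (3 / 256 : ℂ) * hpi

theorem hasSum_binomCoeff_mul_betaIntegral :
    HasSum (fun k ↦ binomCoeff k * betaIntegral (k + 5 / 2) 2) (betaIntegral (5 / 2) (7 / 2)) := by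
  simp_rw [betaIntegral, ← intervalIntegral.integral_const_mul]
  refine intervalIntegral.hasSum_integral_of_dominated_convergence
    (fun k _ ↦ ‖binomCoeff k‖) (fun k ↦ ?_) (fun k ↦ ?_) ?_ (by simp) ?_
  · have hre : 0 < (k + 5 / 2 : ℂ).re := by
      simp; positivity
    have := (betaIntegral_convergent hre (v := 2) (by norm_num)).const_mul (binomCoeff k)
    exact (intervalIntegrable_iff.1 this).aestronglyMeasurable
  · refine .of_forall fun t ht ↦ ?_
    rw [Set.uIoc_of_le zero_le_one] at ht
    have h1 : ‖(t : ℂ) ^ (k + 5 / 2 - 1 : ℂ)‖ ≤ 1 := by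
      rw [norm_cpow_eq_rpow_re_of_pos ht.1]
      refine Real.rpow_le_one ht.1.le ht.2 ?_
      norm_num
      linarith [Nat.cast_nonneg (α := ℝ) k]
    have h2 : ‖(1 - t : ℂ) ^ (2 - 1 : ℂ)‖ ≤ 1 := by
      rw [show (2 - 1 : ℂ) = 1 by norm_num, cpow_one,
        show (1 - t : ℂ) = ((1 - t : ℝ) : ℂ) by push_cast; rfl, norm_real, Real.norm_eq_abs,
        abs_le]
      constructor <;> linarith [ht.1, ht.2]
    rw [norm_mul, norm_mul]
    exact mul_le_of_le_one_right (norm_nonneg _) (mul_le_one₀ h1 (norm_nonneg _) h2)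
  · exact .of_forall fun t _ ↦ summable_norm_binomCoeff
  · refine .of_forall fun t ht ↦ ?_
    rw [Set.uIoc_of_le zero_le_one] at ht
    rcases ht.2.eq_or_lt with rfl | ht1
    · norm_num
    have ht0 : (t : ℂ) ≠ 0 := by exact_mod_cast ht.1.ne'
    have ht1' : (1 - t : ℂ) ≠ 0 := by exact_mod_cast (sub_pos.2 ht1).ne'
    convert! (hasSum_binomCoeff ht.1 ht1).mul_right ((t : ℂ) ^ (3 / 2 : ℂ) * (1 - t)) using 1
    · funext k
      rw [show (k + 5 / 2 - 1 : ℂ) = k + 3 / 2 by ring, cpow_add _ _ ht0, cpow_natCast,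
        show (2 - 1 : ℂ) = 1 by norm_num, cpow_one]
      ring
    · rw [show (5 / 2 - 1 : ℂ) = 3 / 2 by norm_num, show (7 / 2 - 1 : ℂ) = 3 / 2 + 1 by norm_num,
        cpow_add _ _ ht1', cpow_one]
      ring

/-- The terms of the series `₂F₁(5/2, -3/2; 9/2; 1)`. -/
noncomputable def gaussTerm (k : ℕ) : ℂ := 35 / ((2 * k + 5) * (2 * k + 7)) * binomCoeff k

theorem hasSum_gaussTerm : HasSum gaussTerm (105 * Real.pi / 1024) := by
  convert! hasSum_binomCoeff_mul_betaIntegral.mul_left (35 / 4) using 1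
  · funext k
    rw [betaIntegral_add_two, gaussTerm]
    ring
  · rw [betaIntegral_five_halves_seven_halves]
    ring

theorem sum_range_gaussTerm (n : ℕ) :
    ∑ k ∈ Finset.range n, (k + 3 / 2) * gaussTerm k
      = -(7 * n / (2 * n + 5)) * binomCoeff n := by
  induction n with
  | zero => simp
  | succ n ih =>
    rw [Finset.sum_range_succ, ih, binomCoeff_succ, gaussTerm]
    have h1 : (n + 1 : ℂ) ≠ 0 := by exact_mod_cast n.succ_ne_zero
    have h5 : (n * 2 + 5 : ℂ) ≠ 0 := by exact_mod_cast (by omega : n * 2 + 5 ≠ 0)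
    have h7 : (n * 2 + 7 : ℂ) ≠ 0 := by exact_mod_cast (by omega : n * 2 + 7 ≠ 0)
    rw [show (2 * (n + 1 : ℕ) + 5 : ℂ) = 2 * n + 7 by push_cast; ring]
    push_cast
    field_simp
    ring

theorem hasSum_natCast_mul_gaussTerm :
    HasSum (fun k : ℕ ↦ k * gaussTerm k) (-(3 / 2) * (105 * Real.pi / 1024)) := by
  have hs : Summable fun k : ℕ ↦ (k : ℂ) * gaussTerm k := by
    refine .of_norm_bounded (summable_norm_binomCoeff.mul_left 1) fun k ↦ ?_
    rw [gaussTerm, ← mul_assoc, norm_mul]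
    gcongr
    have e : (k : ℂ) * (35 / ((2 * k + 5) * (2 * k + 7)))
        = (k * (35 / ((2 * k + 5) * (2 * k + 7))) : ℝ) := by push_cast; rfl
    rw [e, norm_real, Real.norm_of_nonneg (by positivity), mul_div_assoc',
      div_le_one (by positivity)]
    nlinarith [sq_nonneg ((k : ℝ) - 2), Nat.cast_nonneg (α := ℝ) k]
  have hz : Tendsto (fun n : ℕ ↦ -(7 * n / (2 * n + 5) : ℂ) * binomCoeff n) atTop (𝓝 0) := by
    refine squeeze_zero_norm (fun n ↦ ?_)
      (by simpa using summable_norm_binomCoeff.tendsto_atTop_zero.const_mul 7)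
    rw [norm_mul]
    gcongr
    have e : -(7 * n / (2 * n + 5) : ℂ) = (-(7 * n / (2 * n + 5)) : ℝ) := by push_cast; rfl
    rw [e, norm_real, norm_neg, Real.norm_of_nonneg (by positivity), div_le_iff₀ (by positivity)]
    linarith [Nat.cast_nonneg (α := ℝ) n]
  have h := (hs.hasSum.add (hasSum_gaussTerm.mul_left (3 / 2))).tendsto_sum_nat
  simp_rw [← add_mul, sum_range_gaussTerm] at h
  have h0 := tendsto_nhds_unique h hz
  convert! hs.hasSum using 1
  linear_combination -h0

theorem pi_formula_m2 (d : ℂ) (hd : 0 < d.re) :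
    hyp [5/2, -3/2, d + 1] [9/2, d] 1 =
      105 * (Real.pi : ℂ) / 1024 * (1 - 3 / (2 * d)) := by
  have h := hasSum_gaussTerm.add (hasSum_natCast_mul_gaussTerm.mul_right d⁻¹)
  rw [hyp]
  convert! h.tsum_eq using 1
  · refine tsum_congr fun k ↦ ?_
    have e : ([5 / 2, -3 / 2, d + 1].map (poch · k)).prod / ([9 / 2, d].map (poch · k)).prod
          * 1 ^ k / (k ! : ℂ)
        = poch (5 / 2) k / poch (9 / 2) k * (poch (d + 1) k / poch d k) * binomCoeff k := by
      simp only [List.map_cons, List.map_nil, List.prod_cons, List.prod_nil, binomCoeff, one_pow]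
      ring
    rw [e, poch_add_one_div hd, poch_five_halves_div, gaussTerm]
    ring
  · ring
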